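/- arXiv:1412.4507 — 2 statements merged into one kernel-verified Lean document; each statement's English description precedes it below -/
import Mathlib

section
/- Let $M \ge 0$ be a random variable whose tail satisfies $\mathbb{P}(M > x) \sim c\, x^{-\kappa}$ as $x \to \infty$ for some constants $c > 0$ and $1 < \kappa < 2$. Then as $a \to \infty$, $\mathbb{E}\left[ \frac{M^2}{a + M} \right] \sim c\, c_\kappa\, a^{1-\kappa}$, where $c_\kappa = \int_0^\infty \frac{(2+y)\, y^{1-\kappa}}{(1+y)^2}\, dy = \kappa\, \mathrm{B}(2-\kappa, \kappa-1)$ and $\mathrm{B}$ is the Beta function. -/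
open MeasureTheory Filter

open Set in
theorem integral_Ioo_rpow_mul_one_sub_rpow {α β : ℝ} (hα : 0 < α) (hβ : 0 < β) :
    ∫ t in Ioo (0 : ℝ) 1, t ^ (α - 1) * (1 - t) ^ (β - 1) = ProbabilityTheory.beta α β := by
  have hb := ProbabilityTheory.beta_pos hα hβ
  have h1 : ∫ t in Ioo (0 : ℝ) 1,
      1 / ProbabilityTheory.beta α β * t ^ (α - 1) * (1 - t) ^ (β - 1) = 1 := by
    rw [integral_eq_lintegral_of_nonneg_ae, ← ProbabilityTheory.lintegral_betaPDF,
      ProbabilityTheory.lintegral_betaPDF_eq_one hα hβ, ENNReal.toReal_one]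
    · refine ae_restrict_of_forall_mem measurableSet_Ioo fun t ht => ?_
      have h0 : 0 < t := ht.1
      have h1 : 0 < 1 - t := sub_pos.2 ht.2
      simp only [Pi.zero_apply]
      positivity
    · exact Measurable.aestronglyMeasurable (by fun_prop)
  simp_rw [mul_assoc, integral_const_mul] at h1
  field_simp at h1
  exact h1

open Set in
theorem image_div_one_add_Ioi : (fun y : ℝ => y / (1 + y)) '' Ioi 0 = Ioo 0 1 := by
  ext t
  constructor
  · rintro ⟨y, hy, rfl⟩
    have hy : 0 < y := hy
    exact ⟨by positivity, by rw [div_lt_one (by positivity)]; linarith⟩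
  · rintro ⟨h0, h1⟩
    have h2 : 0 < 1 - t := sub_pos.2 h1
    refine ⟨t / (1 - t), div_pos h0 h2, ?_⟩
    field_simp
    ring

open Set in
/-- The Beta integral over the half-line. -/
theorem integral_Ioi_rpow_mul_one_add_rpow {α β : ℝ} (hα : 0 < α) (hβ : 0 < β) :
    ∫ y in Ioi (0 : ℝ), y ^ (α - 1) * (1 + y) ^ (-(α + β)) = ProbabilityTheory.beta α β := by
  rw [← integral_Ioo_rpow_mul_one_sub_rpow hα hβ, ← image_div_one_add_Ioi,
    integral_image_eq_integral_abs_deriv_smul (f' := fun y => 1 / (1 + y) ^ 2) measurableSet_Ioi]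
  · refine setIntegral_congr_fun measurableSet_Ioi fun y hy => ?_
    have hy : 0 < y := hy
    have h1 : 0 < 1 + y := by positivity
    have h2 : 1 - y / (1 + y) = (1 + y)⁻¹ := by field_simp; ring
    have h3 : |1 / (1 + y) ^ 2| = (1 + y) ^ (-2 : ℝ) := by
      rw [abs_of_pos (by positivity), Real.rpow_neg h1.le, Real.rpow_two, one_div]
    simp only [smul_eq_mul]
    rw [h2, h3, Real.div_rpow hy.le h1.le, Real.inv_rpow h1.le, ← Real.rpow_neg h1.le,
      div_eq_mul_inv, ← Real.rpow_neg h1.le]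
    have h4 : (1 + y) ^ (-(α + β)) =
        (1 + y) ^ (-2 : ℝ) * (1 + y) ^ (-(α - 1)) * (1 + y) ^ (-(β - 1)) := by
      rw [← Real.rpow_add h1, ← Real.rpow_add h1]
      congr 1
      ring
    rw [h4]
    ring
  · intro y hy
    have hy : 0 < y := hy
    have h1 : 1 + y ≠ 0 := by positivity
    have := (hasDerivAt_id' y).div ((hasDerivAt_id' y).const_add 1) h1
    refine (this.congr_deriv ?_).hasDerivWithinAt
    field_simp
    ring
  · intro x hx y hy hxy
    have hx : 0 < x := hx
    have hy : 0 < y := hy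
    have h : x / (1 + x) = y / (1 + y) := hxy
    field_simp at h
    linarith

open Set in
theorem integrableOn_Ioi_rpow_mul_one_add_rpow {α β : ℝ} (hα : 0 < α) (hβ : 0 < β) :
    IntegrableOn (fun y : ℝ => y ^ (α - 1) * (1 + y) ^ (-(α + β))) (Ioi 0) := by
  by_contra h
  have h1 := integral_Ioi_rpow_mul_one_add_rpow hα hβ
  rw [integral_undef h] at h1
  exact (ProbabilityTheory.beta_pos hα hβ).ne h1

theorem beta_add_beta_add_one {α β : ℝ} (hβ : 0 < β) (h : α + β = 1) :
    ProbabilityTheory.beta α β + ProbabilityTheory.beta α (β + 1) =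
      (β + 1) * ProbabilityTheory.beta α β := by
  unfold ProbabilityTheory.beta
  rw [← add_assoc, h, Real.Gamma_add_one hβ.ne', one_add_one_eq_two, Real.Gamma_two,
    Real.Gamma_one]
  ring

theorem two_add_mul_rpow_div_eq {κ y : ℝ} (hy : 0 < y) :
    (2 + y) * y ^ (1 - κ) / (1 + y) ^ 2 =
      y ^ ((2 - κ) - 1) * (1 + y) ^ (-((2 - κ) + (κ - 1))) +
        y ^ ((2 - κ) - 1) * (1 + y) ^ (-((2 - κ) + (κ - 1 + 1))) := by
  have h1 : 0 < 1 + y := by positivity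
  rw [show (2 - κ) - 1 = 1 - κ by ring, show -((2 - κ) + (κ - 1)) = -1 by ring,
    show -((2 - κ) + (κ - 1 + 1)) = -2 by ring, Real.rpow_neg_one, Real.rpow_neg h1.le,
    Real.rpow_two]
  field_simp
  ring

open Set in
theorem integrableOn_two_add_mul_rpow_div {κ : ℝ} (hκ1 : 1 < κ) (hκ2 : κ < 2) :
    IntegrableOn (fun y : ℝ => (2 + y) * y ^ (1 - κ) / (1 + y) ^ 2) (Ioi 0) :=
  ((integrableOn_Ioi_rpow_mul_one_add_rpow (by linarith) (by linarith)).add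
    (integrableOn_Ioi_rpow_mul_one_add_rpow (by linarith) (by linarith))).congr_fun
    (fun _ hy => (two_add_mul_rpow_div_eq hy).symm) measurableSet_Ioi

open Set in
theorem integral_two_add_mul_rpow_div {κ : ℝ} (hκ1 : 1 < κ) (hκ2 : κ < 2) :
    ∫ y in Ioi (0 : ℝ), (2 + y) * y ^ (1 - κ) / (1 + y) ^ 2 =
      κ * ProbabilityTheory.beta (2 - κ) (κ - 1) := by
  have hα : 0 < 2 - κ := by linarith
  have hβ : 0 < κ - 1 := by linarith
  have hβ' : 0 < κ - 1 + 1 := by linarith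
  rw [setIntegral_congr_fun measurableSet_Ioi fun y hy => two_add_mul_rpow_div_eq hy,
    integral_add (integrableOn_Ioi_rpow_mul_one_add_rpow hα hβ)
      (integrableOn_Ioi_rpow_mul_one_add_rpow hα hβ'),
    integral_Ioi_rpow_mul_one_add_rpow hα hβ, integral_Ioi_rpow_mul_one_add_rpow hα hβ',
    beta_add_beta_add_one hβ (by ring), sub_add_cancel]

theorem integral_mul_two_add_div {t : ℝ} (ht : 0 ≤ t) :
    ∫ y in (0 : ℝ)..t, y * (2 + y) / (1 + y) ^ 2 = t ^ 2 / (1 + t) := by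
  have hne : ∀ y ∈ Set.uIcc 0 t, 1 + y ≠ 0 := fun y hy => by
    rw [Set.uIcc_of_le ht] at hy
    linarith [hy.1]
  rw [intervalIntegral.integral_eq_sub_of_hasDerivAt (f := fun y => y ^ 2 / (1 + y))]
  · simp
  · intro y hy
    have := (hasDerivAt_pow 2 y).div ((hasDerivAt_id' y).const_add 1) (hne y hy)
    refine this.congr_deriv ?_
    congr 1
    push_cast
    ring
  · refine ContinuousOn.intervalIntegrable ?_
    exact ContinuousOn.div (by fun_prop) (by fun_prop) fun y hy => pow_ne_zero 2 (hne y hy)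

section Tail

variable {Ω : Type*} [MeasurableSpace Ω] {μ : Measure Ω} {M : Ω → ℝ}

theorem antitone_measure_toReal_lt [IsFiniteMeasure μ] :
    Antitone fun x : ℝ => (μ {ω | x < M ω}).toReal := fun _ _ hxy =>
  ENNReal.toReal_mono (measure_ne_top _ _) (measure_mono fun _ h => hxy.trans_lt h)

/-- Layer cake formula for the truncated second moment, rescaled by `a`. -/
theorem integral_sq_div_add_eq [IsFiniteMeasure μ] (hM : Measurable M) (hpos : ∀ ω, 0 ≤ M ω)
    {a : ℝ} (ha : 0 < a) :
    ∫ ω, M ω ^ 2 / (a + M ω) ∂μ =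
      a * ∫ y in Set.Ioi (0 : ℝ), y * (2 + y) / (1 + y) ^ 2 * (μ {ω | a * y < M ω}).toReal := by
  have hscale : ∀ ω, M ω ^ 2 / (a + M ω) = a * ((M ω / a) ^ 2 / (1 + M ω / a)) := fun ω => by
    have := hpos ω
    field_simp
  have hnn : ∀ ω, 0 ≤ M ω / a := fun ω => div_nonneg (hpos ω) ha.le
  simp_rw [hscale, integral_const_mul]
  congr 1
  rw [integral_eq_lintegral_of_nonneg_ae, integral_eq_lintegral_of_nonneg_ae]
  · congr 1
    have key := lintegral_comp_eq_lintegral_meas_lt_mul μ (f := fun ω => M ω / a)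
      (g := fun y => y * (2 + y) / (1 + y) ^ 2) (Eventually.of_forall hnn)
      (hM.div_const a).aemeasurable ?_ ?_
    · simp_rw [fun ω => integral_mul_two_add_div (hnn ω)] at key
      rw [key]
      refine setLIntegral_congr_fun measurableSet_Ioi fun y hy => ?_
      have hy : 0 < y := hy
      rw [ENNReal.ofReal_mul (by positivity), ENNReal.ofReal_toReal (measure_ne_top _ _), mul_comm]
      simp_rw [lt_div_iff₀ ha, mul_comm y a]
    · intro t ht
      refine ContinuousOn.intervalIntegrable ?_
      refine ContinuousOn.div (by fun_prop) (by fun_prop) fun y hy => ?_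
      rw [Set.uIcc_of_le ht.le] at hy
      have := hy.1
      positivity
    · refine ae_restrict_of_forall_mem measurableSet_Ioi fun y hy => ?_
      have hy : 0 < y := hy
      positivity
  · refine ae_restrict_of_forall_mem measurableSet_Ioi fun y hy => ?_
    have hy : 0 < y := hy
    simp only [Pi.zero_apply]
    positivity
  · have : Measurable fun y : ℝ => (μ {ω | a * y < M ω}).toReal :=
      antitone_measure_toReal_lt.measurable.comp (measurable_const_mul a)
    exact Measurable.aestronglyMeasurable (by fun_prop)
  · refine Eventually.of_forall fun ω => ?_
    have := hnn ω
    simp only [Pi.zero_apply]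
    positivity
  · exact Measurable.aestronglyMeasurable (by fun_prop)

theorem exists_tail_le_mul_rpow [IsProbabilityMeasure μ] {c κ : ℝ} (hc : 0 < c) (hκ : 0 < κ)
    (htail : Tendsto (fun x : ℝ => (μ {ω | x < M ω}).toReal / (c * x ^ (-κ))) atTop (nhds 1)) :
    ∃ C, ∀ x, 0 < x → (μ {ω | x < M ω}).toReal ≤ C * x ^ (-κ) := by
  obtain ⟨x₀, hx₀⟩ := eventually_atTop.1 (htail.eventually_lt_const one_lt_two)
  set x₁ := max x₀ 1
  have hx₁ : 0 < x₁ := lt_of_lt_of_le one_pos (le_max_right _ _)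
  refine ⟨max (2 * c) (x₁ ^ κ), fun x hx => ?_⟩
  have hxκ : 0 < x ^ (-κ) := Real.rpow_pos_of_pos hx _
  rcases le_total x₁ x with h | h
  · have h1 := hx₀ x ((le_max_left _ _).trans h)
    rw [div_lt_iff₀ (by positivity)] at h1
    calc (μ {ω | x < M ω}).toReal ≤ 2 * c * x ^ (-κ) := by linarith
      _ ≤ _ := by gcongr; exact le_max_left _ _
  · calc (μ {ω | x < M ω}).toReal ≤ 1 := by
          simpa using ENNReal.toReal_mono ENNReal.one_ne_top (prob_le_one (μ := μ))
      _ = x ^ κ * x ^ (-κ) := by rw [← Real.rpow_add hx]; simp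
      _ ≤ x₁ ^ κ * x ^ (-κ) := by gcongr
      _ ≤ _ := by gcongr; exact le_max_right _ _

theorem tendsto_rpow_mul_tail {c κ : ℝ} (hc : 0 < c)
    (htail : Tendsto (fun x : ℝ => (μ {ω | x < M ω}).toReal / (c * x ^ (-κ))) atTop (nhds 1))
    {y : ℝ} (hy : 0 < y) :
    Tendsto (fun a : ℝ => a ^ κ * (μ {ω | a * y < M ω}).toReal) atTop (nhds (c * y ^ (-κ))) := by
  have h := (htail.comp (tendsto_id.atTop_mul_const hy)).mul_const (c * y ^ (-κ))
  rw [one_mul] at h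
  refine h.congr' ?_
  filter_upwards [eventually_gt_atTop 0] with a ha
  simp only [Function.comp_apply, id_eq]
  rw [Real.mul_rpow ha.le hy.le, Real.rpow_neg ha.le]
  field_simp

theorem tendsto_integral_mul_tail [IsProbabilityMeasure μ] {c κ : ℝ} (hc : 0 < c) (hκ1 : 1 < κ)
    (hκ2 : κ < 2)
    (htail : Tendsto (fun x : ℝ => (μ {ω | x < M ω}).toReal / (c * x ^ (-κ))) atTop (nhds 1)) :
    Tendsto (fun a : ℝ => ∫ y in Set.Ioi (0 : ℝ),
        y * (2 + y) / (1 + y) ^ 2 * (a ^ κ * (μ {ω | a * y < M ω}).toReal)) atTop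
      (nhds (c * ∫ y in Set.Ioi (0 : ℝ), (2 + y) * y ^ (1 - κ) / (1 + y) ^ 2)) := by
  obtain ⟨C, hC⟩ := exists_tail_le_mul_rpow hc (one_pos.trans hκ1) htail
  have hpow : ∀ y : ℝ, 0 < y → y ^ (1 - κ) = y * y ^ (-κ) := fun y hy => by
    rw [sub_eq_add_neg, Real.rpow_add hy, Real.rpow_one]
  rw [← integral_const_mul]
  refine tendsto_integral_filter_of_dominated_convergence
    (fun y => C * ((2 + y) * y ^ (1 - κ) / (1 + y) ^ 2)) ?_ ?_
    ((integrableOn_two_add_mul_rpow_div hκ1 hκ2).const_mul C) ?_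
  · refine Eventually.of_forall fun a => ?_
    have : Measurable fun y : ℝ => (μ {ω | a * y < M ω}).toReal :=
      antitone_measure_toReal_lt.measurable.comp (measurable_const_mul a)
    exact Measurable.aestronglyMeasurable (by fun_prop)
  · filter_upwards [eventually_gt_atTop 0] with a ha
    refine ae_restrict_of_forall_mem measurableSet_Ioi fun y hy => ?_
    have hy : 0 < y := hy
    have h1 : a ^ κ * (μ {ω | a * y < M ω}).toReal ≤ C * y ^ (-κ) := by
      calc a ^ κ * (μ {ω | a * y < M ω}).toReal ≤ a ^ κ * (C * (a * y) ^ (-κ)) := by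
            gcongr
            exact hC _ (by positivity)
        _ = C * y ^ (-κ) := by
            rw [Real.mul_rpow ha.le hy.le, Real.rpow_neg ha.le]
            field_simp
    rw [Real.norm_of_nonneg (by positivity), hpow y hy]
    calc y * (2 + y) / (1 + y) ^ 2 * (a ^ κ * (μ {ω | a * y < M ω}).toReal)
        ≤ y * (2 + y) / (1 + y) ^ 2 * (C * y ^ (-κ)) := by gcongr
      _ = _ := by ring
  · refine ae_restrict_of_forall_mem measurableSet_Ioi fun y hy => ?_
    have h := (tendsto_rpow_mul_tail hc htail hy).const_mul (y * (2 + y) / (1 + y) ^ 2)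
    rw [hpow y hy]
    convert! h using 2
    ring

end Tail

theorem stmt_9 {Ω : Type*} [MeasurableSpace Ω] (μ : Measure Ω) [IsProbabilityMeasure μ]
    (M : Ω → ℝ) (hM : Measurable M) (hpos : ∀ ω, 0 ≤ M ω)
    (c κ : ℝ) (hc : 0 < c) (hκ1 : 1 < κ) (hκ2 : κ < 2)
    (htail : Tendsto (fun x : ℝ => (μ {ω | x < M ω}).toReal / (c * x ^ (-κ))) atTop (nhds 1)) :
    (∫ y in Set.Ioi (0 : ℝ), (2 + y) * y ^ (1 - κ) / (1 + y) ^ 2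
        = κ * (Real.Gamma (2 - κ) * Real.Gamma (κ - 1) / Real.Gamma ((2 - κ) + (κ - 1)))) ∧
    Tendsto (fun a : ℝ =>
        (∫ ω, M ω ^ 2 / (a + M ω) ∂μ)
          / (c * (κ * (Real.Gamma (2 - κ) * Real.Gamma (κ - 1) / Real.Gamma ((2 - κ) + (κ - 1))))
              * a ^ (1 - κ)))
      atTop (nhds 1) := by
  have hint := integral_two_add_mul_rpow_div hκ1 hκ2
  refine ⟨hint, ?_⟩
  have hb : 0 < ProbabilityTheory.beta (2 - κ) (κ - 1) :=
    ProbabilityTheory.beta_pos (by linarith) (by linarith)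
  change Tendsto (fun a : ℝ => (∫ ω, M ω ^ 2 / (a + M ω) ∂μ) /
    (c * (κ * ProbabilityTheory.beta (2 - κ) (κ - 1)) * a ^ (1 - κ))) atTop (nhds 1)
  have hK : 0 < c * (κ * ProbabilityTheory.beta (2 - κ) (κ - 1)) := by positivity
  have h := (tendsto_integral_mul_tail hc hκ1 hκ2 htail).div_const
    (c * (κ * ProbabilityTheory.beta (2 - κ) (κ - 1)))
  rw [hint, div_self hK.ne'] at h
  refine h.congr' ?_
  filter_upwards [eventually_gt_atTop 0] with a ha
  rw [integral_sq_div_add_eq hM hpos ha, Real.rpow_sub ha, Real.rpow_one]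
  simp_rw [mul_left_comm _ (a ^ κ), integral_const_mul]
  generalize ∫ y in Set.Ioi (0 : ℝ), y * (2 + y) / (1 + y) ^ 2 * (μ {ω | a * y < M ω}).toReal = I
  have := (Real.rpow_pos_of_pos ha κ).ne'
  field_simp
end

section
/- Let $\phi : [0,\infty) \to [0,\infty)$ be a convex $C^1$ function and let $\xi$ be a nonnegative random variable with $0 < \mathbb{E}[\xi] < \infty$. Write $\langle \eta \rangle := \eta / \mathbb{E}[\eta]$ for a nonnegative integrable random variable $\eta$ with positive mean. Then for every $0 \le \varepsilon < 1$, $\mathbb{E}\left[ \phi\left( \left\langle \frac{\varepsilon + \xi}{1 + \xi} \right\rangle \right) \right] \le \mathbb{E}\left[ \phi\left( \langle \xi \rangle \right) \right]$. -/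
open MeasureTheory

/-- A differentiable convex function has slope at least its derivative at `c` between two points
lying on the right of `c`, and at most this derivative between two points on the left of `c`. -/
theorem ConvexOn.derivWithin_mul_sub_le_sub {φ : ℝ → ℝ} {s : Set ℝ} (hφ : ConvexOn ℝ s φ)
    {c x y : ℝ} (hc : c ∈ s) (hx : x ∈ s) (hd : DifferentiableWithinAt ℝ φ s c)
    (h : c ≤ y ∧ y ≤ x ∨ x ≤ y ∧ y ≤ c) :
    derivWithin φ s c * (x - y) ≤ φ x - φ y := by
  rcases h with ⟨hcy, hyx⟩ | ⟨hxy, hyc⟩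
  · have hy : y ∈ s := hφ.1.ordConnected.out hc hx ⟨hcy, hyx⟩
    rcases hyx.eq_or_lt with rfl | hyx
    · simp
    have hs : derivWithin φ s c ≤ slope φ y x := by
      rcases hcy.eq_or_lt with rfl | hcy
      · exact hφ.derivWithin_le_slope hc hx hyx hd
      · refine (hφ.derivWithin_le_slope hc hy hcy hd).trans ?_
        simpa only [slope_def_field] using hφ.slope_mono_adjacent hc hx hcy hyx
    rwa [slope_def_field, le_div_iff₀ (sub_pos.2 hyx)] at hs
  · have hy : y ∈ s := hφ.1.ordConnected.out hx hc ⟨hxy, hyc⟩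
    rcases hxy.eq_or_lt with rfl | hxy
    · simp
    have hs : slope φ x y ≤ derivWithin φ s c := by
      rcases hyc.eq_or_lt with rfl | hyc
      · exact hφ.slope_le_derivWithin hx hc hxy hd
      · refine le_trans ?_ (hφ.slope_le_derivWithin hy hc hyc hd)
        simpa only [slope_def_field] using hφ.slope_mono_adjacent hx hc hxy hyc
    rw [slope_def_field, div_le_iff₀ (sub_pos.2 hxy)] at hs
    linarith

/-- The increasing functions `x ↦ x / m` and `x ↦ (ε + x) / (1 + x) / M` cross only once on
`[0, ∞)`, the second one being above the first one before the crossing and below it after. -/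
theorem exists_crossing_div_moebius {ε m M : ℝ} (hε0 : 0 ≤ ε) (hε1 : ε < 1) (hm : 0 < m)
    (hM : 0 < M) :
    ∃ c : ℝ, 0 ≤ c ∧ ∀ x : ℝ, 0 ≤ x →
      c ≤ (ε + x) / (1 + x) / M ∧ (ε + x) / (1 + x) / M ≤ x / m ∨
      x / m ≤ (ε + x) / (1 + x) / M ∧ (ε + x) / (1 + x) / M ≤ c := by
  obtain ⟨a, ha, hroot, hlarge⟩ : ∃ a : ℝ, 0 ≤ a ∧ M * a ^ 2 + (M - m) * a = m * ε ∧
      0 ≤ M * a + M - m := by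
    set r := √((m - M) ^ 2 + 4 * M * m * ε)
    have hr2 : r ^ 2 = (m - M) ^ 2 + 4 * M * m * ε := Real.sq_sqrt (by positivity)
    have hr : |m - M| ≤ r := Real.abs_le_sqrt (le_add_of_nonneg_right (by positivity))
    obtain ⟨h1, h2⟩ := abs_le.1 hr
    have hMa : M * ((m - M + r) / (2 * M)) = (m - M + r) / 2 := by field_simp
    refine ⟨(m - M + r) / (2 * M), div_nonneg (by linarith) (by positivity), ?_, by linarith⟩
    field_simp
    linear_combination hr2
  have mono {x y : ℝ} (hx : 0 ≤ x) (hxy : x ≤ y) :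
      (ε + x) / (1 + x) / M ≤ (ε + y) / (1 + y) / M := by
    gcongr ?_ / M
    rw [div_le_div_iff₀ (by positivity) (by linarith)]
    nlinarith [mul_nonneg (sub_nonneg.2 hε1.le) (sub_nonneg.2 hxy)]
  refine ⟨(ε + a) / (1 + a) / M, by positivity, fun x hx => ?_⟩
  have hfac : x * ((1 + x) * M) - (ε + x) * m = (x - a) * (M * x + (M * a + M - m)) := by
    linear_combination hroot
  have hnn : 0 ≤ M * x + (M * a + M - m) := by positivity
  rcases le_total a x with hax | hxa
  · refine .inl ⟨mono ha hax, ?_⟩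
    rw [div_div, div_le_div_iff₀ (by positivity) hm]
    linarith [mul_nonneg (sub_nonneg.2 hax) hnn]
  · refine .inr ⟨?_, mono hx hxa⟩
    rw [div_div, div_le_div_iff₀ hm (by positivity)]
    linarith [mul_nonneg (sub_nonneg.2 hxa) hnn]

theorem stmt_18 {Ω : Type*} [MeasurableSpace Ω] (μ : Measure Ω) [IsProbabilityMeasure μ]
    (φ : ℝ → ℝ) (hconv : ConvexOn ℝ (Set.Ici (0 : ℝ)) φ)
    (hC1 : ContDiffOn ℝ 1 φ (Set.Ici (0 : ℝ)))
    (hφpos : ∀ x : ℝ, 0 ≤ x → 0 ≤ φ x)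
    (ξ : Ω → ℝ) (hξ : Integrable ξ μ) (hpos : ∀ ω, 0 ≤ ξ ω)
    (hmean : 0 < ∫ ω, ξ ω ∂μ)
    (hRint : Integrable (fun ω => φ (ξ ω / ∫ ω', ξ ω' ∂μ)) μ)
    (ε : ℝ) (hε0 : 0 ≤ ε) (hε1 : ε < 1) :
    ∫ ω, φ ((ε + ξ ω) / (1 + ξ ω) / ∫ ω', (ε + ξ ω') / (1 + ξ ω') ∂μ) ∂μ
      ≤ ∫ ω, φ (ξ ω / ∫ ω', ξ ω' ∂μ) ∂μ := by
  have hη0 (ω : Ω) : 0 ≤ (ε + ξ ω) / (1 + ξ ω) :=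
    div_nonneg (add_nonneg hε0 (hpos ω)) (add_nonneg zero_le_one (hpos ω))
  have hη : Integrable (fun ω => (ε + ξ ω) / (1 + ξ ω)) μ := by
    refine .of_bound (C := 1) ?_ (.of_forall fun ω => ?_)
    · exact ((hξ.aemeasurable.const_add ε).div (hξ.aemeasurable.const_add 1)).aestronglyMeasurable
    · rw [Real.norm_of_nonneg (hη0 ω)]
      exact div_le_one_of_le₀ (by linarith) (add_nonneg zero_le_one (hpos ω))
  have hM : 0 < ∫ ω, (ε + ξ ω) / (1 + ξ ω) ∂μ := by
    refine (integral_nonneg hη0).lt_of_ne' fun h => hmean.ne' ?_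
    refine integral_eq_zero_of_ae ?_
    filter_upwards [(integral_eq_zero_iff_of_nonneg hη0 hη).1 h] with ω hω
    rcases div_eq_zero_iff.1 hω with h | h <;> simp only [Pi.zero_apply] <;> linarith [hpos ω]
  by_cases hLint : Integrable
      (fun ω => φ ((ε + ξ ω) / (1 + ξ ω) / ∫ ω', (ε + ξ ω') / (1 + ξ ω') ∂μ)) μ
  swap
  · rw [integral_undef hLint]
    exact integral_nonneg fun ω => hφpos _ (div_nonneg (hpos ω) hmean.le)
  obtain ⟨c, hc, hcross⟩ := exists_crossing_div_moebius hε0 hε1 hmean hM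
  have key := integral_mono (((hξ.div_const _).sub (hη.div_const _)).const_mul
    (derivWithin φ (Set.Ici 0) c)) (hRint.sub hLint) fun ω =>
      hconv.derivWithin_mul_sub_le_sub hc (div_nonneg (hpos ω) hmean.le)
        (hC1.differentiableOn one_ne_zero c hc) (hcross (ξ ω) (hpos ω))
  simp only [Pi.sub_apply] at key
  rw [integral_const_mul, integral_sub (hξ.div_const _) (hη.div_const _), integral_div,
    integral_div, div_self hmean.ne', div_self hM.ne', sub_self, mul_zero,
    integral_sub hRint hLint] at key
  exact sub_nonneg.1 key
end
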